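/- For all nonzero complex numbers a, b, the operator N = a·N2 + b·N3 on the 20-dimensional ℂ-vector space R satisfies N⁵ = 0, rank N = 8, rank N² = 6, rank N³ = 4 and rank N⁴ = 2; equivalently, the Jordan normal form of N consists of ten 1×1 zero blocks and two nilpotent Jordan blocks of size 5. In particular dim Ker N = 12, which is strictly larger than 10 = dim H*(Gr(2,5)). -/

import Mathlib

noncomputable section
open MvPolynomial

/-! ## The ring R = H*(X_res) for the toric degeneration of Gr(2,5) -/

abbrev Poly3 := MvPolynomial (Fin 3) ℂ

/-- ⟨m2², m3², m1²(m1−m2)(m1−m2−m3)(m1−m3)⟩. -/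
def IR : Ideal Poly3 :=
  Ideal.span {X 1 ^ 2, X 2 ^ 2,
    X 0 ^ 2 * (X 0 - X 1) * (X 0 - X 1 - X 2) * (X 0 - X 2)}

abbrev R := Poly3 ⧸ IR

def m1 : R := Ideal.Quotient.mk IR (X 0)
def m2 : R := Ideal.Quotient.mk IR (X 1)
def m3 : R := Ideal.Quotient.mk IR (X 2)

/-- The 20-element monomial basis of R. -/
def mon : Fin 20 → R :=
  ![1, m1, m2, m3, m1 ^ 2, m1 * m2, m1 * m3, m2 * m3,
    m1 ^ 3, m1 ^ 2 * m2, m1 ^ 2 * m3, m1 * m2 * m3,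
    m1 ^ 4, m1 ^ 3 * m2, m1 ^ 3 * m3, m1 ^ 2 * (m2 * m3),
    m1 ^ 5, m1 ^ 4 * m2, m1 ^ 4 * m3, m1 ^ 6]

/-- β = (m1−m2)(m1−m2−m3). -/
def β : R := (m1 - m2) * (m1 - m2 - m3)
/-- β' = (m1−m3)(m1−m2−m3). -/
def β' : R := (m1 - m3) * (m1 - m2 - m3)
/-- γ = (m1−m2)(m1−m3)(m1−m2−m3). -/
def γ : R := (m1 - m2) * (m1 - m3) * (m1 - m2 - m3)

/-- The images of the basis monomials under N2 (the residue at q2 = 1 of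
quantum multiplication by m2, evaluated at (q2,q3) = (1,1)). -/
def N2img : Fin 20 → R :=
  ![0, 0, -β, 0, 0, -(m1 * β), 0, -(m3 * β) - γ,
    0, -(m1 ^ 2 * β), 0, -(m1 * m3 * β) - m1 * γ,
    0, -(m1 ^ 3 * β), 0, -(m1 ^ 2 * (m3 * β)),
    0, 0, 0, 0]

/-- The images of the basis monomials under N3 (the residue at q3 = 1 of
quantum multiplication by m3, evaluated at (q2,q3) = (1,1)). -/
def N3img : Fin 20 → R :=
  ![0, 0, 0, -β', 0, 0, -(m1 * β'), -(m2 * β') - γ,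
    0, 0, -(m1 ^ 2 * β'), -(m1 * m2 * β') - m1 * γ,
    0, 0, -(m1 ^ 3 * β'), -(m1 ^ 2 * (m2 * β')),
    0, 0, 0, 0]

/-- Differences of ranks of successive powers of an endomorphism are nonincreasing. -/
theorem finrank_range_pow_convex {K V : Type*} [Field K] [AddCommGroup V] [Module K V]
    [FiniteDimensional K V] (f : Module.End K V) (k : ℕ) :
    2 * Module.finrank K (LinearMap.range (f ^ (k + 1))) ≤
      Module.finrank K (LinearMap.range (f ^ k)) +
        Module.finrank K (LinearMap.range (f ^ (k + 2))) := by
  have step : ∀ n, Module.finrank K (LinearMap.range (f ^ (n + 1))) +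
      Module.finrank K (LinearMap.ker (f.domRestrict (LinearMap.range (f ^ n)))) =
        Module.finrank K (LinearMap.range (f ^ n)) := by
    intro n
    rw [← LinearMap.finrank_range_add_finrank_ker (f.domRestrict (LinearMap.range (f ^ n))),
      LinearMap.range_domRestrict, pow_succ', Module.End.mul_eq_comp, LinearMap.range_comp]
  have mono : Module.finrank K (LinearMap.ker (f.domRestrict (LinearMap.range (f ^ (k + 1))))) ≤
      Module.finrank K (LinearMap.ker (f.domRestrict (LinearMap.range (f ^ k)))) := by
    have hle : LinearMap.range (f ^ (k + 1)) ≤ LinearMap.range (f ^ k) := by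
      rw [pow_succ, Module.End.mul_eq_comp]
      exact LinearMap.range_comp_le_range _ _
    rw [LinearMap.ker_domRestrict, LinearMap.ker_domRestrict,
      ← Submodule.finrank_map_subtype_eq,
      ← Submodule.finrank_map_subtype_eq (LinearMap.range (f ^ k)),
      Submodule.map_comap_subtype, Submodule.map_comap_subtype]
    exact Submodule.finrank_mono (inf_le_inf_right _ hle)
  have h0 := step k
  have h1 := step (k + 1)
  rw [show k + 1 + 1 = k + 2 from rfl] at h1
  omega

/-- A nilpotent endomorphism of index at most `5` with `rank f ≤ 8` and `rank f⁴ ≥ 2` has its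
ranks forced. -/
theorem finrank_range_pow_of_bounds {K V : Type*} [Field K] [AddCommGroup V] [Module K V]
    [FiniteDimensional K V] (f : Module.End K V) (h5 : f ^ 5 = 0)
    (h1 : Module.finrank K (LinearMap.range f) ≤ 8)
    (h4 : 2 ≤ Module.finrank K (LinearMap.range (f ^ 4))) :
    Module.finrank K (LinearMap.range f) = 8 ∧
    Module.finrank K (LinearMap.range (f ^ 2)) = 6 ∧
    Module.finrank K (LinearMap.range (f ^ 3)) = 4 ∧
    Module.finrank K (LinearMap.range (f ^ 4)) = 2 := by
  have c1 := finrank_range_pow_convex f 1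
  have c2 := finrank_range_pow_convex f 2
  have c3 := finrank_range_pow_convex f 3
  have e5 : Module.finrank K (LinearMap.range (f ^ 5)) = 0 := by
    rw [h5, LinearMap.range_zero, finrank_bot]
  have e1 : Module.finrank K (LinearMap.range (f ^ 1)) = Module.finrank K (LinearMap.range f) := by
    rw [pow_one]
  simp only [Nat.reduceAdd] at c1 c2 c3
  omega

/-- The exponent vector `(i, j, k)`. -/
def expVec (i j k : ℕ) : Fin 3 →₀ ℕ :=
  Finsupp.single 0 i + Finsupp.single 1 j + Finsupp.single 2 k

theorem expVec_inj {i j k i' j' k' : ℕ} :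
    expVec i j k = expVec i' j' k' ↔ i = i' ∧ j = j' ∧ k = k' := by
  simp [Finsupp.ext_iff, Fin.forall_fin_succ, expVec, Finsupp.single_apply]

theorem coeff_expVec_mul_X0 (i j k : ℕ) (q : Poly3) :
    coeff (expVec i j k) (q * X 0) = if i = 0 then 0 else coeff (expVec (i - 1) j k) q := by
  rw [coeff_mul_X']
  rcases i with _ | i
  · simp [expVec]
  · rw [if_pos (by simp [expVec]), if_neg (by simp)]
    congr 1
    ext x
    fin_cases x <;> simp [expVec]

theorem coeff_expVec_mul_X1 (i j k : ℕ) (q : Poly3) :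
    coeff (expVec i j k) (q * X 1) = if j = 0 then 0 else coeff (expVec i (j - 1) k) q := by
  rw [coeff_mul_X']
  rcases j with _ | j
  · simp [expVec]
  · rw [if_pos (by simp [expVec]), if_neg (by simp)]
    congr 1
    ext x
    fin_cases x <;> simp [expVec]

theorem coeff_expVec_mul_X2 (i j k : ℕ) (q : Poly3) :
    coeff (expVec i j k) (q * X 2) = if k = 0 then 0 else coeff (expVec i j (k - 1)) q := by
  rw [coeff_mul_X']
  rcases k with _ | k
  · simp [expVec]
  · rw [if_pos (by simp [expVec]), if_neg (by simp)]
    congr 1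
    ext x
    fin_cases x <;> simp [expVec]

/-- The degree functional on polynomials, normalised by `m1⁴ m2 m3 ↦ 1`. -/
def polyDegree : Poly3 →ₗ[ℂ] ℂ :=
  lcoeff ℂ (expVec 4 1 1) + (2 : ℂ) • lcoeff ℂ (expVec 5 1 0) +
    (2 : ℂ) • lcoeff ℂ (expVec 5 0 1) + (5 : ℂ) • lcoeff ℂ (expVec 6 0 0)

theorem polyDegree_apply (p : Poly3) :
    polyDegree p = coeff (expVec 4 1 1) p + 2 * coeff (expVec 5 1 0) p +
      2 * coeff (expVec 5 0 1) p + 5 * coeff (expVec 6 0 0) p := by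
  simp [polyDegree]

theorem polyDegree_eq_zero_of_mem {p : Poly3} (hp : p ∈ IR) : polyDegree p = 0 := by
  rw [IR, Ideal.mem_span_insert] at hp
  obtain ⟨q₁, z, hz, rfl⟩ := hp
  rw [Ideal.mem_span_pair] at hz
  obtain ⟨q₂, q₃, rfl⟩ := hz
  have e₁ : q₁ * (X 1 : Poly3) ^ 2 = q₁ * X 1 * X 1 := by ring
  have e₂ : q₂ * (X 2 : Poly3) ^ 2 = q₂ * X 2 * X 2 := by ring
  have e₃ : q₃ * ((X 0 : Poly3) ^ 2 * (X 0 - X 1) * (X 0 - X 1 - X 2) * (X 0 - X 2)) =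
      q₃ * X 0 * X 0 * X 0 * X 0 * X 0
        - (q₃ * X 1 * X 0 * X 0 * X 0 * X 0 + q₃ * X 1 * X 0 * X 0 * X 0 * X 0)
        - (q₃ * X 2 * X 0 * X 0 * X 0 * X 0 + q₃ * X 2 * X 0 * X 0 * X 0 * X 0)
        + (q₃ * X 1 * X 2 * X 0 * X 0 * X 0 + q₃ * X 1 * X 2 * X 0 * X 0 * X 0
          + q₃ * X 1 * X 2 * X 0 * X 0 * X 0)
        + q₃ * X 1 * X 1 * X 0 * X 0 * X 0 + q₃ * X 2 * X 2 * X 0 * X 0 * X 0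
        - q₃ * X 1 * X 1 * X 2 * X 0 * X 0 - q₃ * X 1 * X 2 * X 2 * X 0 * X 0 := by ring
  rw [e₁, e₂, e₃, polyDegree_apply]
  simp only [coeff_add, coeff_sub, coeff_expVec_mul_X0, coeff_expVec_mul_X1, coeff_expVec_mul_X2]
  norm_num
  ring

/-- The degree functional (integration over the fundamental class) on `R`. -/
def degreeR : R →ₗ[ℂ] ℂ :=
  (IR.restrictScalars ℂ).liftQ polyDegree fun _ hp => polyDegree_eq_zero_of_mem hp

theorem degreeR_monomial (i j k : ℕ) :
    degreeR (m1 ^ i * m2 ^ j * m3 ^ k) =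
      if i = 4 ∧ j = 1 ∧ k = 1 then 1 else if i = 5 ∧ j = 1 ∧ k = 0 then 2
        else if i = 5 ∧ j = 0 ∧ k = 1 then 2 else if i = 6 ∧ j = 0 ∧ k = 0 then 5 else 0 := by
  have h : degreeR (m1 ^ i * m2 ^ j * m3 ^ k) =
      polyDegree (X 0 ^ i * X 1 ^ j * X 2 ^ k) := rfl
  have h' : (X 0 ^ i * X 1 ^ j * X 2 ^ k : Poly3) = monomial (expVec i j k) 1 := by
    simp [expVec, X_pow_eq_monomial, monomial_mul]
  rw [h, h', polyDegree_apply]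
  simp only [coeff_monomial, expVec_inj]
  split_ifs <;> first | omega | norm_num

theorem m2_sq : m2 ^ 2 = 0 :=
  Ideal.Quotient.eq_zero_iff_mem.2 (Ideal.subset_span (by simp))

theorem m3_sq : m3 ^ 2 = 0 :=
  Ideal.Quotient.eq_zero_iff_mem.2 (Ideal.subset_span (by simp))

theorem m1_sq_mul_γ : m1 ^ 2 * γ = 0 := by
  have h : m1 ^ 2 * (m1 - m2) * (m1 - m2 - m3) * (m1 - m3) = 0 :=
    Ideal.Quotient.eq_zero_iff_mem.2 (Ideal.subset_span (by simp))
  rw [γ]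
  linear_combination h

theorem m1_pow_five :
    m1 ^ 5 = 2 * (m1 ^ 4 * m2) + 2 * (m1 ^ 4 * m3) - 3 * (m1 ^ 3 * m2 * m3) := by
  have h := m1_sq_mul_γ
  rw [γ] at h
  linear_combination h + (-m1 ^ 3 + m1 ^ 2 * m3) * m2_sq + (-m1 ^ 3 + m1 ^ 2 * m2) * m3_sq

theorem m1_pow_five_mul_m2 : m1 ^ 5 * m2 = 2 * (m1 ^ 4 * m2 * m3) := by
  linear_combination m2 * m1_pow_five + (2 * m1 ^ 4 - 3 * m1 ^ 3 * m3) * m2_sq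

theorem m1_pow_five_mul_m3 : m1 ^ 5 * m3 = 2 * (m1 ^ 4 * m2 * m3) := by
  linear_combination m3 * m1_pow_five + (2 * m1 ^ 4 - 3 * m1 ^ 3 * m2) * m3_sq

theorem m1_pow_six : m1 ^ 6 = 5 * (m1 ^ 4 * m2 * m3) := by
  linear_combination m1 * m1_pow_five + 2 * m1_pow_five_mul_m2 + 2 * m1_pow_five_mul_m3

theorem m1_pow_five_mul_m2_mul_m3 : m1 ^ 5 * m2 * m3 = 0 := by
  linear_combination m3 * m1_pow_five_mul_m2 + 2 * m1 ^ 4 * m2 * m3_sq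

theorem m1_pow_six_mul_m2 : m1 ^ 6 * m2 = 0 := by
  linear_combination m2 * m1_pow_six + 5 * m1 ^ 4 * m3 * m2_sq

theorem m1_pow_six_mul_m3 : m1 ^ 6 * m3 = 0 := by
  linear_combination m3 * m1_pow_six + 5 * m1 ^ 4 * m2 * m3_sq

theorem m1_pow_seven : m1 ^ 7 = 0 := by
  linear_combination m1 * m1_pow_six + 5 * m1_pow_five_mul_m2_mul_m3

theorem natCast_smul_R (n : ℕ) (x : R) : (n : ℂ) • x = n * x := by
  rw [Nat.cast_smul_eq_nsmul, nsmul_eq_mul]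

theorem monomial_mem_span_mon (i j k : ℕ) :
    m1 ^ i * m2 ^ j * m3 ^ k ∈ Submodule.span ℂ (Set.range mon) := by
  have hm : ∀ n, mon n ∈ Submodule.span ℂ (Set.range mon) := fun n =>
    Submodule.subset_span ⟨n, rfl⟩
  have h311 : m1 ^ 3 * m2 * m3 ∈ Submodule.span ℂ (Set.range mon) := by
    rw [← Submodule.smul_mem_iff _ (Nat.cast_ne_zero.2 three_ne_zero : ((3 : ℕ) : ℂ) ≠ 0)]
    have h := sub_mem (add_mem (Submodule.smul_mem _ ((2 : ℕ) : ℂ) (hm 17))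
      (Submodule.smul_mem _ ((2 : ℕ) : ℂ) (hm 18))) (hm 16)
    rw [natCast_smul_R, natCast_smul_R] at h
    rw [natCast_smul_R]
    refine (congrArg (· ∈ Submodule.span ℂ (Set.range mon)) ?_).mpr h
    change _ = ((2 : ℕ) : R) * (m1 ^ 4 * m2) + ((2 : ℕ) : R) * (m1 ^ 4 * m3) - m1 ^ 5
    push_cast
    linear_combination m1_pow_five
  have h411 : m1 ^ 4 * m2 * m3 ∈ Submodule.span ℂ (Set.range mon) := by
    rw [← Submodule.smul_mem_iff _ (Nat.cast_ne_zero.2 (by norm_num) : ((5 : ℕ) : ℂ) ≠ 0),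
      natCast_smul_R, Nat.cast_ofNat, ← m1_pow_six]
    exact hm 19
  have h2 : 2 * (m1 ^ 4 * m2 * m3) ∈ Submodule.span ℂ (Set.range mon) := by
    rw [two_mul]
    exact add_mem h411 h411
  by_cases hj : 2 ≤ j
  · rw [pow_eq_zero_of_le hj m2_sq, mul_zero, zero_mul]
    exact zero_mem _
  by_cases hk : 2 ≤ k
  · rw [pow_eq_zero_of_le hk m3_sq, mul_zero]
    exact zero_mem _
  by_cases hi : 7 ≤ i
  · rw [pow_eq_zero_of_le hi m1_pow_seven, zero_mul, zero_mul]
    exact zero_mem _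
  have hj' : j = 0 ∨ j = 1 := by omega
  have hk' : k = 0 ∨ k = 1 := by omega
  rcases hj' with rfl | rfl <;> rcases hk' with rfl | rfl <;>
    simp only [pow_zero, pow_one, mul_one]
  · have hi' : i = 0 ∨ i = 1 ∨ i = 2 ∨ i = 3 ∨ i = 4 ∨ i = 5 ∨ i = 6 := by omega
    rcases hi' with rfl | rfl | rfl | rfl | rfl | rfl | rfl
    · rw [pow_zero]
      exact hm 0
    · rw [pow_one]
      exact hm 1
    · exact hm 4
    · exact hm 8
    · exact hm 12
    · exact hm 16
    · exact hm 19
  · have hi' : i = 0 ∨ i = 1 ∨ i = 2 ∨ i = 3 ∨ i = 4 ∨ i = 5 ∨ i = 6 := by omega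
    rcases hi' with rfl | rfl | rfl | rfl | rfl | rfl | rfl
    · rw [pow_zero, one_mul]
      exact hm 3
    · rw [pow_one]
      exact hm 6
    · exact hm 10
    · exact hm 14
    · exact hm 18
    · rwa [m1_pow_five_mul_m3]
    · rw [m1_pow_six_mul_m3]
      exact zero_mem _
  · have hi' : i = 0 ∨ i = 1 ∨ i = 2 ∨ i = 3 ∨ i = 4 ∨ i = 5 ∨ i = 6 := by omega
    rcases hi' with rfl | rfl | rfl | rfl | rfl | rfl | rfl
    · rw [pow_zero, one_mul]
      exact hm 2
    · rw [pow_one]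
      exact hm 5
    · exact hm 9
    · exact hm 13
    · exact hm 17
    · rwa [m1_pow_five_mul_m2]
    · rw [m1_pow_six_mul_m2]
      exact zero_mem _
  · have hi' : i = 0 ∨ i = 1 ∨ i = 2 ∨ i = 3 ∨ i = 4 ∨ i = 5 ∨ i = 6 := by omega
    rcases hi' with rfl | rfl | rfl | rfl | rfl | rfl | rfl
    · rw [pow_zero, one_mul]
      exact hm 7
    · rw [pow_one]
      exact hm 11
    · rw [mul_assoc]
      exact hm 15
    · exact h311
    · exact h411
    · rw [m1_pow_five_mul_m2_mul_m3]
      exact zero_mem _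
    · rw [m1_pow_six_mul_m2, zero_mul]
      exact zero_mem _

theorem span_mon : Submodule.span ℂ (Set.range mon) = ⊤ := by
  rw [eq_top_iff]
  rintro x -
  obtain ⟨p, rfl⟩ := Ideal.Quotient.mk_surjective x
  induction p using MvPolynomial.induction_on' with
  | monomial u c =>
    have h : Ideal.Quotient.mk IR (monomial u c) =
        c • (m1 ^ u 0 * m2 ^ u 1 * m3 ^ u 2) := by
      have h' : (monomial u c : Poly3) = c • (X 0 ^ u 0 * X 1 ^ u 1 * X 2 ^ u 2) := by
        rw [monomial_eq, Finsupp.prod_fintype _ _ (by simp), Fin.prod_univ_three,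
          MvPolynomial.smul_eq_C_mul]
      rw [h']
      rfl
    rw [h]
    exact Submodule.smul_mem _ _ (monomial_mem_span_mon _ _ _)
  | add p q hp hq =>
    rw [map_add]
    exact add_mem hp hq

/-- The exponents of the basis monomials. -/
def monExp : Fin 20 → ℕ × ℕ × ℕ :=
  ![(0, 0, 0), (1, 0, 0), (0, 1, 0), (0, 0, 1), (2, 0, 0), (1, 1, 0), (1, 0, 1), (0, 1, 1),
    (3, 0, 0), (2, 1, 0), (2, 0, 1), (1, 1, 1), (4, 0, 0), (3, 1, 0), (3, 0, 1), (2, 1, 1),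
    (5, 0, 0), (4, 1, 0), (4, 0, 1), (6, 0, 0)]

theorem mon_eq (n : Fin 20) :
    mon n = m1 ^ (monExp n).1 * m2 ^ (monExp n).2.1 * m3 ^ (monExp n).2.2 := by
  fin_cases n <;> simp [mon, monExp, mul_assoc]

theorem pairing_eq_zero {g : Fin 20 → ℂ} (hg : ∑ n, g n • mon n = 0) (i j k : ℕ) :
    ∑ n, g n * degreeR
      (m1 ^ (i + (monExp n).1) * m2 ^ (j + (monExp n).2.1) * m3 ^ (k + (monExp n).2.2)) = 0 := by
  have h := congrArg (fun x => degreeR (m1 ^ i * m2 ^ j * m3 ^ k * x)) hg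
  simp only [Finset.mul_sum, map_sum, mul_zero, map_zero, mul_smul_comm, map_smul,
    smul_eq_mul] at h
  rw [← h]
  refine Finset.sum_congr rfl fun n _ => ?_
  rw [mon_eq]
  congr 2
  ring

set_option maxHeartbeats 1000000 in
theorem linearIndependent_mon : LinearIndependent ℂ mon := by
  rw [Fintype.linearIndependent_iff]
  intro g hg
  have key := pairing_eq_zero hg
  clear hg
  simp only [degreeR_monomial, Fin.sum_univ_succ, monExp] at key
  have k600 := key 6 0 0
  have k500 := key 5 0 0
  have k410 := key 4 1 0
  have k401 := key 4 0 1
  have k400 := key 4 0 0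
  have k310 := key 3 1 0
  have k301 := key 3 0 1
  have k211 := key 2 1 1
  have k300 := key 3 0 0
  have k210 := key 2 1 0
  have k201 := key 2 0 1
  have k111 := key 1 1 1
  have k200 := key 2 0 0
  have k110 := key 1 1 0
  have k101 := key 1 0 1
  have k011 := key 0 1 1
  have k100 := key 1 0 0
  have k010 := key 0 1 0
  have k001 := key 0 0 1
  have k000 := key 0 0 0
  clear key
  simp at k600 k500 k410 k401 k400 k310 k301 k211 k300 k210 k201 k111 k200 k110 k101 k011
  simp at k100 k010 k001 k000
  intro i
  fin_cases i <;> simp only [Fin.reduceFinMk, Fin.zero_eta, Fin.mk_one] <;> grind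

theorem N2img_eq : N2img = ![0, 0, -β, 0, 0, -(m1 * β), 0, -(m1 * β), 0, -(m1 ^ 2 * β), 0,
    -(m1 ^ 2 * β), 0, -(m1 ^ 3 * β), 0, -(m1 ^ 3 * β), 0, 0, 0, 0] := by
  have h7 : -(m3 * β) - γ = -(m1 * β) := by
    rw [β, γ]
    ring
  have h11 : -(m1 * m3 * β) - m1 * γ = -(m1 ^ 2 * β) := by
    rw [β, γ]
    ring
  have h15 : -(m1 ^ 2 * (m3 * β)) = -(m1 ^ 3 * β) := by
    have h := m1_sq_mul_γ
    rw [γ] at h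
    rw [β]
    linear_combination h
  rw [N2img, h7, h11, h15]

theorem N3img_eq : N3img = ![0, 0, 0, -β', 0, 0, -(m1 * β'), -(m1 * β'), 0, 0, -(m1 ^ 2 * β'),
    -(m1 ^ 2 * β'), 0, 0, -(m1 ^ 3 * β'), -(m1 ^ 3 * β'), 0, 0, 0, 0] := by
  have h7 : -(m2 * β') - γ = -(m1 * β') := by
    rw [β', γ]
    ring
  have h11 : -(m1 * m2 * β') - m1 * γ = -(m1 ^ 2 * β') := by
    rw [β', γ]
    ring
  have h15 : -(m1 ^ 2 * (m2 * β')) = -(m1 ^ 3 * β') := by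
    have h := m1_sq_mul_γ
    rw [γ] at h
    rw [β']
    linear_combination h
  rw [N3img, h7, h11, h15]

theorem m1_pow_four_mul_β : m1 ^ 4 * β = 0 := by
  rw [β]
  linear_combination m1_pow_six - 2 * m1_pow_five_mul_m2 - m1_pow_five_mul_m3 + m1 ^ 4 * m2_sq

theorem m1_pow_four_mul_β' : m1 ^ 4 * β' = 0 := by
  rw [β']
  linear_combination m1_pow_six - m1_pow_five_mul_m2 - 2 * m1_pow_five_mul_m3 + m1 ^ 4 * m3_sq

theorem m1_pow_add_four_mul_β (k : ℕ) : m1 ^ (k + 4) * β = 0 := by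
  rw [pow_add, mul_assoc, m1_pow_four_mul_β, mul_zero]

theorem β_eq : β = mon 4 - mon 5 - mon 5 - mon 6 + mon 7 := by
  change β = m1 ^ 2 - m1 * m2 - m1 * m2 - m1 * m3 + m2 * m3
  rw [β]
  linear_combination m2_sq

theorem m1_mul_β : m1 * β = mon 8 - mon 9 - mon 9 - mon 10 + mon 11 := by
  change m1 * β = m1 ^ 3 - m1 ^ 2 * m2 - m1 ^ 2 * m2 - m1 ^ 2 * m3 + m1 * m2 * m3
  rw [β]
  linear_combination m1 * m2_sq

theorem m1_sq_mul_β : m1 ^ 2 * β = mon 12 - mon 13 - mon 13 - mon 14 + mon 15 := by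
  change m1 ^ 2 * β = m1 ^ 4 - m1 ^ 3 * m2 - m1 ^ 3 * m2 - m1 ^ 3 * m3 + m1 ^ 2 * (m2 * m3)
  rw [β]
  linear_combination m1 ^ 2 * m2_sq

theorem three_mul_m1_pow_three_mul_β :
    ((3 : ℕ) : ℂ) • (m1 ^ 3 * β) =
      mon 16 + mon 16 - mon 17 - mon 17 - mon 17 - mon 17 - mon 18 := by
  rw [natCast_smul_R]
  change _ = m1 ^ 5 + m1 ^ 5 - m1 ^ 4 * m2 - m1 ^ 4 * m2 - m1 ^ 4 * m2 - m1 ^ 4 * m2 - m1 ^ 4 * m3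
  rw [β]
  push_cast
  linear_combination m1_pow_five + 3 * m1 ^ 3 * m2_sq

theorem m1_pow_add_four_mul_β' (k : ℕ) : m1 ^ (k + 4) * β' = 0 := by
  rw [pow_add, mul_assoc, m1_pow_four_mul_β', mul_zero]

theorem β'_eq : β' = mon 4 - mon 6 - mon 6 - mon 5 + mon 7 := by
  change β' = m1 ^ 2 - m1 * m3 - m1 * m3 - m1 * m2 + m2 * m3
  rw [β']
  linear_combination m3_sq

theorem m1_mul_β' : m1 * β' = mon 8 - mon 10 - mon 10 - mon 9 + mon 11 := by
  change m1 * β' = m1 ^ 3 - m1 ^ 2 * m3 - m1 ^ 2 * m3 - m1 ^ 2 * m2 + m1 * m2 * m3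
  rw [β']
  linear_combination m1 * m3_sq

theorem m1_sq_mul_β' : m1 ^ 2 * β' = mon 12 - mon 14 - mon 14 - mon 13 + mon 15 := by
  change m1 ^ 2 * β' = m1 ^ 4 - m1 ^ 3 * m3 - m1 ^ 3 * m3 - m1 ^ 3 * m2 + m1 ^ 2 * (m2 * m3)
  rw [β']
  linear_combination m1 ^ 2 * m3_sq

theorem three_mul_m1_pow_three_mul_β' :
    ((3 : ℕ) : ℂ) • (m1 ^ 3 * β') =
      mon 16 + mon 16 - mon 18 - mon 18 - mon 18 - mon 18 - mon 17 := by
  rw [natCast_smul_R]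
  change _ = m1 ^ 5 + m1 ^ 5 - m1 ^ 4 * m3 - m1 ^ 4 * m3 - m1 ^ 4 * m3 - m1 ^ 4 * m3 - m1 ^ 4 * m2
  rw [β']
  push_cast
  linear_combination m1_pow_five + 3 * m1 ^ 3 * m3_sq

theorem degreeR_m2_mul_β : degreeR (m2 * (m1 ^ 3 * β)) = 1 := by
  have h : m2 * (m1 ^ 3 * β) = m1 ^ 4 * m2 ^ 1 * m3 ^ 1 := by
    rw [β]
    linear_combination m1_pow_five_mul_m2 + (m1 ^ 3 * m2 + m1 ^ 3 * m3 - 2 * m1 ^ 4) * m2_sq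
  rw [h, degreeR_monomial]
  simp

theorem degreeR_m3_mul_β : degreeR (m3 * (m1 ^ 3 * β)) = 0 := by
  have h : m3 * (m1 ^ 3 * β) = 0 := by
    rw [β]
    linear_combination m1_pow_five_mul_m3 + m1 ^ 3 * m3 * m2_sq + (m1 ^ 3 * m2 - m1 ^ 4) * m3_sq
  rw [h, map_zero]

theorem degreeR_m3_mul_β' : degreeR (m3 * (m1 ^ 3 * β')) = 1 := by
  have h : m3 * (m1 ^ 3 * β') = m1 ^ 4 * m2 ^ 1 * m3 ^ 1 := by
    rw [β']
    linear_combination m1_pow_five_mul_m3 + (m1 ^ 3 * m2 + m1 ^ 3 * m3 - 2 * m1 ^ 4) * m3_sq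
  rw [h, degreeR_monomial]
  simp

theorem degreeR_m2_mul_β' : degreeR (m2 * (m1 ^ 3 * β')) = 0 := by
  have h : m2 * (m1 ^ 3 * β') = 0 := by
    rw [β']
    linear_combination m1_pow_five_mul_m2 + m1 ^ 3 * m2 * m3_sq + (m1 ^ 3 * m3 - m1 ^ 4) * m2_sq
  rw [h, map_zero]

/-- The monomial basis of `R`. -/
def monBasis : Module.Basis (Fin 20) ℂ R :=
  Module.Basis.mk linearIndependent_mon span_mon.ge

theorem finrank_cohomology : Module.finrank ℂ R = 20 := by
  rw [Module.finrank_eq_card_basis monBasis, Fintype.card_fin]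

section Operator

variable {N : Module.End ℂ R} {a b : ℂ}

theorem apply_m1_pow_mul_β (hN : ∀ i, N (mon i) = a • N2img i + b • N3img i) (k : ℕ) :
    N (m1 ^ k * β) = a • (m1 ^ (k + 1) * β) := by
  simp only [N2img_eq, N3img_eq] at hN
  rcases k with _ | _ | _ | _ | k
  · rw [pow_zero, one_mul, zero_add, pow_one, β_eq, map_add, map_sub, map_sub, map_sub, hN, hN,
      hN, hN, ← β_eq]
    simp
    module
  · rw [zero_add, pow_one, m1_mul_β, map_add, map_sub, map_sub, map_sub, hN, hN, hN, hN]
    simp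
    module
  · rw [m1_sq_mul_β, map_add, map_sub, map_sub, map_sub, hN, hN, hN, hN]
    simp
    module
  · rw [m1_pow_four_mul_β, smul_zero,
      ← smul_eq_zero_iff_right (Nat.cast_ne_zero.2 three_ne_zero : ((3 : ℕ) : ℂ) ≠ 0), ← map_smul,
      three_mul_m1_pow_three_mul_β]
    simp [hN]
  · rw [show m1 ^ (k + 1 + 1 + 1 + 1) * β = 0 from m1_pow_add_four_mul_β k,
      show m1 ^ (k + 1 + 1 + 1 + 1 + 1) * β = 0 from m1_pow_add_four_mul_β (k + 1),
      map_zero, smul_zero]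

theorem apply_m1_pow_mul_β' (hN : ∀ i, N (mon i) = a • N2img i + b • N3img i) (k : ℕ) :
    N (m1 ^ k * β') = b • (m1 ^ (k + 1) * β') := by
  simp only [N2img_eq, N3img_eq] at hN
  rcases k with _ | _ | _ | _ | k
  · rw [pow_zero, one_mul, zero_add, pow_one, β'_eq, map_add, map_sub, map_sub, map_sub, hN, hN,
      hN, hN, ← β'_eq]
    simp
  · rw [zero_add, pow_one, m1_mul_β', map_add, map_sub, map_sub, map_sub, hN, hN, hN, hN]
    simp
  · rw [m1_sq_mul_β', map_add, map_sub, map_sub, map_sub, hN, hN, hN, hN]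
    simp
  · rw [m1_pow_four_mul_β', smul_zero,
      ← smul_eq_zero_iff_right (Nat.cast_ne_zero.2 three_ne_zero : ((3 : ℕ) : ℂ) ≠ 0), ← map_smul,
      three_mul_m1_pow_three_mul_β']
    simp [hN]
  · rw [show m1 ^ (k + 1 + 1 + 1 + 1) * β' = 0 from m1_pow_add_four_mul_β' k,
      show m1 ^ (k + 1 + 1 + 1 + 1 + 1) * β' = 0 from m1_pow_add_four_mul_β' (k + 1),
      map_zero, smul_zero]

theorem pow_apply_m1_pow_mul_β (hN : ∀ i, N (mon i) = a • N2img i + b • N3img i) (n k : ℕ) :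
    (N ^ n) (m1 ^ k * β) = a ^ n • (m1 ^ (k + n) * β) := by
  induction n with
  | zero => rw [pow_zero, pow_zero, one_smul, add_zero, Module.End.one_apply]
  | succ n ih =>
    rw [pow_succ', Module.End.mul_apply, ih, map_smul, apply_m1_pow_mul_β hN, smul_smul,
      pow_succ a, add_assoc]

theorem pow_apply_m1_pow_mul_β' (hN : ∀ i, N (mon i) = a • N2img i + b • N3img i) (n k : ℕ) :
    (N ^ n) (m1 ^ k * β') = b ^ n • (m1 ^ (k + n) * β') := by
  induction n with
  | zero => rw [pow_zero, pow_zero, one_smul, add_zero, Module.End.one_apply]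
  | succ n ih =>
    rw [pow_succ', Module.End.mul_apply, ih, map_smul, apply_m1_pow_mul_β' hN, smul_smul,
      pow_succ b, add_assoc]

theorem forall_mem_of_mem_left {V : Type*} [AddCommGroup V] [Module ℂ V] {S : Submodule ℂ V}
    {x y z w : V} (hx : x ∈ S) (hy : y ∈ S) (hz : z ∈ S) (hw : w ∈ S) (i : Fin 20) :
    ![0, 0, -x, 0, 0, -y, 0, -y, 0, -z, 0, -z, 0, -w, 0, -w, 0, 0, 0, 0] i ∈ S := by
  fin_cases i <;> simp [*]

theorem forall_mem_of_mem_right {V : Type*} [AddCommGroup V] [Module ℂ V] {S : Submodule ℂ V}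
    {x y z w : V} (hx : x ∈ S) (hy : y ∈ S) (hz : z ∈ S) (hw : w ∈ S) (i : Fin 20) :
    ![0, 0, 0, -x, 0, 0, -y, -y, 0, 0, -z, -z, 0, 0, -w, -w, 0, 0, 0, 0] i ∈ S := by
  fin_cases i <;> simp [*]

theorem range_le_span (hN : ∀ i, N (mon i) = a • N2img i + b • N3img i) :
    LinearMap.range N ≤ Submodule.span ℂ
      (Set.range ![m1 ^ 0 * β, m1 ^ 1 * β, m1 ^ 2 * β, m1 ^ 3 * β,
        m1 ^ 0 * β', m1 ^ 1 * β', m1 ^ 2 * β', m1 ^ 3 * β']) := by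
  set v : Fin 8 → R := ![m1 ^ 0 * β, m1 ^ 1 * β, m1 ^ 2 * β, m1 ^ 3 * β,
    m1 ^ 0 * β', m1 ^ 1 * β', m1 ^ 2 * β', m1 ^ 3 * β'] with hv
  have hm : ∀ n, v n ∈ Submodule.span ℂ (Set.range v) := fun n =>
    Submodule.subset_span ⟨n, rfl⟩
  have h0 : β ∈ Submodule.span ℂ (Set.range v) := by
    simpa only [hv, Matrix.cons_val, pow_zero, one_mul] using hm 0
  have h1 : m1 * β ∈ Submodule.span ℂ (Set.range v) := by
    simpa only [hv, Matrix.cons_val, pow_one] using hm 1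
  have h2 : m1 ^ 2 * β ∈ Submodule.span ℂ (Set.range v) := hm 2
  have h3 : m1 ^ 3 * β ∈ Submodule.span ℂ (Set.range v) := hm 3
  have h4 : β' ∈ Submodule.span ℂ (Set.range v) := by
    simpa only [hv, Matrix.cons_val, pow_zero, one_mul] using hm 4
  have h5 : m1 * β' ∈ Submodule.span ℂ (Set.range v) := by
    simpa only [hv, Matrix.cons_val, pow_one] using hm 5
  have h6 : m1 ^ 2 * β' ∈ Submodule.span ℂ (Set.range v) := hm 6
  have h7 : m1 ^ 3 * β' ∈ Submodule.span ℂ (Set.range v) := hm 7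
  rw [LinearMap.range_eq_map, ← span_mon, Submodule.map_span, Submodule.span_le]
  rintro _ ⟨_, ⟨i, rfl⟩, rfl⟩
  rw [SetLike.mem_coe, hN, N2img_eq, N3img_eq]
  exact add_mem (Submodule.smul_mem _ _ (forall_mem_of_mem_left h0 h1 h2 h3 i))
    (Submodule.smul_mem _ _ (forall_mem_of_mem_right h4 h5 h6 h7 i))

theorem pow_five_eq_zero (hN : ∀ i, N (mon i) = a • N2img i + b • N3img i) : N ^ 5 = 0 := by
  refine monBasis.ext fun i => ?_
  have h : ∀ x ∈ LinearMap.range N, (N ^ 4) x = 0 := by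
    intro x hx
    have hle : LinearMap.range N ≤ LinearMap.ker (N ^ 4) := by
      refine (range_le_span hN).trans (Submodule.span_le.2 ?_)
      have hβ : ∀ k, (N ^ 4) (m1 ^ k * β) = 0 := fun k => by
        rw [pow_apply_m1_pow_mul_β hN, m1_pow_add_four_mul_β, smul_zero]
      have hβ' : ∀ k, (N ^ 4) (m1 ^ k * β') = 0 := fun k => by
        rw [pow_apply_m1_pow_mul_β' hN, m1_pow_add_four_mul_β', smul_zero]
      rintro _ ⟨i, rfl⟩
      rw [SetLike.mem_coe, LinearMap.mem_ker]
      fin_cases i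
      exacts [hβ 0, hβ 1, hβ 2, hβ 3, hβ' 0, hβ' 1, hβ' 2, hβ' 3]
    exact hle hx
  rw [pow_succ, Module.End.mul_apply, LinearMap.zero_apply]
  exact h _ ⟨_, rfl⟩

theorem two_le_finrank_range_pow_four (hN : ∀ i, N (mon i) = a • N2img i + b • N3img i)
    (ha : a ≠ 0) (hb : b ≠ 0) : 2 ≤ Module.finrank ℂ (LinearMap.range (N ^ 4)) := by
  have : FiniteDimensional ℂ R := monBasis.finiteDimensional_of_finite
  have e2 : N m2 = a • -β := by
    refine (hN 2).trans ?_
    rw [N2img_eq, N3img_eq]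
    simp
  have e3 : N m3 = b • -β' := by
    refine (hN 3).trans ?_
    rw [N2img_eq, N3img_eq]
    simp
  have f2 : (N ^ 4) m2 = -a ^ 4 • (m1 ^ 3 * β) := by
    have h := pow_apply_m1_pow_mul_β hN 3 0
    rw [pow_zero, one_mul, zero_add] at h
    rw [pow_succ, Module.End.mul_apply, e2, map_smul, map_neg, h]
    module
  have f3 : (N ^ 4) m3 = -b ^ 4 • (m1 ^ 3 * β') := by
    have h := pow_apply_m1_pow_mul_β' hN 3 0
    rw [pow_zero, one_mul, zero_add] at h
    rw [pow_succ, Module.End.mul_apply, e3, map_smul, map_neg, h]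
    module
  have hli : LinearIndependent ℂ ![(N ^ 4) m2, (N ^ 4) m3] := by
    rw [LinearIndependent.pair_iff]
    intro s t hst
    rw [f2, f3] at hst
    have k2 := congrArg (fun x => degreeR (m2 * x)) hst
    have k3 := congrArg (fun x => degreeR (m3 * x)) hst
    simp only [mul_add, mul_smul_comm, map_add, map_smul, degreeR_m2_mul_β, degreeR_m2_mul_β',
      degreeR_m3_mul_β, degreeR_m3_mul_β', mul_zero, map_zero, smul_eq_mul] at k2 k3
    constructor
    · simpa [ha] using k2
    · simpa [hb] using k3
  have hle : Submodule.span ℂ (Set.range ![(N ^ 4) m2, (N ^ 4) m3]) ≤ LinearMap.range (N ^ 4) := by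
    rw [Submodule.span_le]
    rintro _ ⟨i, rfl⟩
    fin_cases i
    · exact ⟨m2, rfl⟩
    · exact ⟨m3, rfl⟩
  have h := Submodule.finrank_mono hle
  rwa [finrank_span_eq_card hli, Fintype.card_fin] at h

end Operator

theorem stmt13
    (N2 N3 : Module.End ℂ R)
    (hN2 : ∀ i, N2 (mon i) = N2img i)
    (hN3 : ∀ i, N3 (mon i) = N3img i)
    (a b : ℂ) (ha : a ≠ 0) (hb : b ≠ 0) :
    (a • N2 + b • N3) ^ 5 = 0 ∧
    Module.finrank ℂ (LinearMap.range (a • N2 + b • N3)) = 8 ∧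
    Module.finrank ℂ (LinearMap.range ((a • N2 + b • N3) ^ 2)) = 6 ∧
    Module.finrank ℂ (LinearMap.range ((a • N2 + b • N3) ^ 3)) = 4 ∧
    Module.finrank ℂ (LinearMap.range ((a • N2 + b • N3) ^ 4)) = 2 ∧
    Module.finrank ℂ (LinearMap.ker (a • N2 + b • N3)) = 12 := by
  have hN : ∀ i, (a • N2 + b • N3) (mon i) = a • N2img i + b • N3img i := fun i => by
    rw [LinearMap.add_apply, LinearMap.smul_apply, LinearMap.smul_apply, hN2, hN3]
  generalize a • N2 + b • N3 = N at hN ⊢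
  have : FiniteDimensional ℂ R := monBasis.finiteDimensional_of_finite
  have h5 := pow_five_eq_zero hN
  have h8 : Module.finrank ℂ (LinearMap.range N) ≤ 8 :=
    (Submodule.finrank_mono (range_le_span hN)).trans
      ((finrank_range_le_card _).trans (Fintype.card_fin 8).le)
  obtain ⟨r1, r2, r3, r4⟩ :=
    finrank_range_pow_of_bounds N h5 h8 (two_le_finrank_range_pow_four hN ha hb)
  have hk := LinearMap.finrank_range_add_finrank_ker N
  rw [r1, finrank_cohomology] at hk
  exact ⟨h5, r1, r2, r3, r4, by omega⟩
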